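/- Target-law identification in the K-variable block-sequential MNAR model: let X = (X_1,…,X_K) be full-data variables with missingness indicators R = (R_1,…,R_K) ∈ {0,1}^K, with strictly positive joint law on the finite product state space. Assume that for every k, the conditional probability P(R_k = 1 | X = x, R_1 = r_1, …, R_{k−1} = r_{k−1}) depends only on (x_1,…,x_{k−1}, r_1,…,r_{k−1}); in particular it does not depend on (x_k,…,x_K). Then for every x: P(X = x) = P(X = x, R = 1) / ∏_{k=1}^K P(R_k = 1 | R_1 = 1, …, R_{k−1} = 1, X_1 = x_1, …, X_{k−1} = x_{k−1}). Since each factor on the right conditions every X_j (j < k) on R_j = 1, the right-hand side is a functional of the observed-data law of (R, L). -/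

import Mathlib

open MeasureTheory

/-- `Pr P A` is the probability of the event `A` under the probability measure `P`. -/
noncomputable def Pr {Ω : Type*} [MeasurableSpace Ω] (P : Measure Ω) (A : Set Ω) : ℝ :=
  (P A).toReal

/-- `cPr P A B` is the conditional probability `P(A | B) = P(A ∩ B) / P(B)`. -/
noncomputable def cPr {Ω : Type*} [MeasurableSpace Ω] (P : Measure Ω) (A B : Set Ω) : ℝ :=
  Pr P (A ∩ B) / Pr P B

theorem Pr_eq_sum_fiber {Ω ι : Type*} [MeasurableSpace Ω] (P : Measure Ω) [IsFiniteMeasure P]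
    [Fintype ι] (F : ι → Set Ω) (hF : ∀ i, MeasurableSet (F i))
    (hdisj : Pairwise (Function.onFun Disjoint F)) (hcover : ⋃ i, F i = Set.univ)
    {A : Set Ω} (hA : MeasurableSet A) :
    Pr P A = ∑ i, Pr P (A ∩ F i) := by
  have hunion : A = ⋃ i, A ∩ F i := by
    rw [← Set.inter_iUnion, hcover, Set.inter_univ]
  have hsum : P A = ∑ i, P (A ∩ F i) := by
    conv_lhs => rw [hunion]
    rw [measure_iUnion (fun i j hij => (hdisj hij).mono Set.inter_subset_right
      Set.inter_subset_right) (fun i => hA.inter (hF i)), tsum_fintype]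
  simp only [Pr]
  rw [hsum, ENNReal.toReal_sum (fun i _ => measure_ne_top P _)]

/-- A conditional probability that is constant along the positive-probability cells of a finite
partition of the conditioning event equals that constant. -/
theorem cPr_eq_of_fiber {Ω ι : Type*} [MeasurableSpace Ω] (P : Measure Ω) [IsFiniteMeasure P]
    [Fintype ι] (F : ι → Set Ω) (hF : ∀ i, MeasurableSet (F i))
    (hdisj : Pairwise (Function.onFun Disjoint F)) (hcover : ⋃ i, F i = Set.univ)
    {A B : Set Ω} (hA : MeasurableSet A) (hB : MeasurableSet B) (hBpos : 0 < Pr P B) {c : ℝ}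
    (hc : ∀ i, B ∩ F i = ∅ ∨ 0 < Pr P (B ∩ F i) ∧ cPr P A (B ∩ F i) = c) :
    cPr P A B = c := by
  rw [cPr, div_eq_iff hBpos.ne', Pr_eq_sum_fiber P F hF hdisj hcover (hA.inter hB),
    Pr_eq_sum_fiber P F hF hdisj hcover hB, Finset.mul_sum]
  refine Finset.sum_congr rfl fun i _ => ?_
  rw [Set.inter_assoc]
  rcases hc i with h | ⟨hpos, h⟩
  · simp [h, Pr]
  · rw [cPr, div_eq_iff hpos.ne'] at h
    exact h

theorem Pr_mono {Ω : Type*} [MeasurableSpace Ω] (P : Measure Ω) [IsFiniteMeasure P]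
    {A B : Set Ω} (h : A ⊆ B) : Pr P A ≤ Pr P B :=
  ENNReal.toReal_mono (measure_ne_top P B) (measure_mono h)

/-- target-law identification in the K-variable block-sequential MNAR model. -/
theorem block_sequential_id
    {Ω : Type*} [MeasurableSpace Ω] (P : Measure Ω) [IsProbabilityMeasure P]
    {K : ℕ} {α : Fin K → Type*} [∀ k, Fintype (α k)] [∀ k, Nonempty (α k)]
    (X : ∀ k, Ω → α k) (R : Fin K → Ω → Bool) (L : ∀ k, Ω → Option (α k))
    (hmX : ∀ (k : Fin K) (a : α k), MeasurableSet {ω | X k ω = a})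
    (hmR : ∀ (k : Fin K) (b : Bool), MeasurableSet {ω | R k ω = b})
    (hL : ∀ (k : Fin K) (ω : Ω), L k ω = if R k ω then some (X k ω) else none)
    -- strict positivity of the joint law
    (hpos : ∀ (x : ∀ k, α k) (r : Fin K → Bool),
      0 < Pr P {ω | (∀ k, X k ω = x k) ∧ (∀ k, R k ω = r k)})
    -- block-sequential restriction: P(R_k = 1 | X = x, R_{<k} = r_{<k}) depends only on
    -- (x_{<k}, r_{<k}); in particular it does not depend on (x_k, …, x_K)
    (hbs : ∀ (k : Fin K) (x x' : ∀ j, α j) (r : Fin K → Bool),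
      (∀ j, j < k → x j = x' j) →
      cPr P {ω | R k ω = true}
        {ω | (∀ j, X j ω = x j) ∧ (∀ j, j < k → R j ω = r j)}
        = cPr P {ω | R k ω = true}
            {ω | (∀ j, X j ω = x' j) ∧ (∀ j, j < k → R j ω = r j)}) :
    ∀ x : (∀ k, α k),
      -- identification of the target law
      (Pr P {ω | ∀ k, X k ω = x k}
        = Pr P {ω | (∀ k, X k ω = x k) ∧ (∀ k, R k ω = true)}
          / ∏ k, cPr P {ω | R k ω = true}
              {ω | (∀ j, j < k → R j ω = true) ∧ (∀ j, j < k → X j ω = x j)})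
      -- each factor is unchanged when the X's are replaced by their proxies,
      -- hence is a functional of the observed-data law of (R, L)
      ∧ (∀ k : Fin K,
          cPr P {ω | R k ω = true}
            {ω | (∀ j, j < k → R j ω = true) ∧ (∀ j, j < k → X j ω = x j)}
          = cPr P {ω | R k ω = true}
              {ω | (∀ j, j < k → R j ω = true) ∧ (∀ j, j < k → L j ω = some (x j))}) := by
  classical
  intro x
  have hfiber : ∀ y : ∀ k, α k, MeasurableSet {ω | ∀ j, X j ω = y j} := fun y => by
    rw [Set.ofPred_forall]
    exact MeasurableSet.iInter fun j => hmX j (y j)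
  have hdisj : Pairwise (Function.onFun Disjoint
      fun y : ∀ k, α k => {ω | ∀ j, X j ω = y j}) := fun y z hyz =>
    Set.disjoint_left.2 fun ω (hy : ∀ j, X j ω = y j) (hz : ∀ j, X j ω = z j) =>
      hyz (funext fun j => (hy j).symm.trans (hz j))
  have hcover : ⋃ y : ∀ k, α k, {ω | ∀ j, X j ω = y j} = Set.univ :=
    Set.eq_univ_of_forall fun ω => Set.mem_iUnion.2 ⟨fun j => X j ω, fun _ => rfl⟩
  have hcell : ∀ (y : ∀ k, α k) (p : Fin K → Prop),
      0 < Pr P {ω | (∀ j, X j ω = y j) ∧ (∀ j, p j → R j ω = true)} := fun y p =>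
    (hpos y fun _ => true).trans_le (Pr_mono P fun ω hω => ⟨hω.1, fun j _ => hω.2 j⟩)
  have hfactor : ∀ k : Fin K,
      cPr P {ω | R k ω = true}
        {ω | (∀ j, j < k → R j ω = true) ∧ (∀ j, j < k → X j ω = x j)}
      = cPr P {ω | R k ω = true}
        {ω | (∀ j, X j ω = x j) ∧ (∀ j, j < k → R j ω = true)} := by
    intro k
    refine cPr_eq_of_fiber P _ hfiber hdisj hcover (hmR k true) ?_ ?_ fun y => ?_
    · simp only [Set.ofPred_and, Set.ofPred_forall]
      exact (MeasurableSet.iInter fun j => MeasurableSet.iInter fun _ => hmR j true).inter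
        (MeasurableSet.iInter fun j => MeasurableSet.iInter fun _ => hmX j (x j))
    · exact (hcell x (· < k)).trans_le (Pr_mono P fun ω hω => ⟨hω.2, fun j _ => hω.1 j⟩)
    · by_cases hxy : ∀ j, j < k → y j = x j
      · right
        have hset : {ω | (∀ j, j < k → R j ω = true) ∧ (∀ j, j < k → X j ω = x j)} ∩
            {ω | ∀ j, X j ω = y j}
            = {ω | (∀ j, X j ω = y j) ∧ (∀ j, j < k → R j ω = true)} := by
          ext ω
          exact ⟨fun h => ⟨h.2, h.1.1⟩,
            fun h => ⟨⟨h.2, fun j hj => (h.1 j).trans (hxy j hj)⟩, h.1⟩⟩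
        rw [hset]
        exact ⟨hcell y (· < k), hbs k y x (fun _ => true) hxy⟩
      · left
        refine Set.eq_empty_of_forall_notMem fun ω hω => hxy fun j hj => ?_
        exact (hω.2 j).symm.trans (hω.1.2 j hj)
  refine ⟨?_, fun k => ?_⟩
  · let f : ℕ → ℝ := fun n =>
      Pr P {ω | (∀ j, X j ω = x j) ∧ (∀ j : Fin K, j.val < n → R j ω = true)}
    have hf : ∀ n, f n ≠ 0 := fun n => (hcell x fun j => j.val < n).ne'
    have hstep : ∀ k : Fin K, cPr P {ω | R k ω = true}
        {ω | (∀ j, j < k → R j ω = true) ∧ (∀ j, j < k → X j ω = x j)}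
        = f (k.val + 1) / f k.val := by
      intro k
      rw [hfactor k, cPr]
      have hset : {ω | R k ω = true} ∩ {ω | (∀ j, X j ω = x j) ∧ (∀ j, j < k → R j ω = true)}
          = {ω | (∀ j, X j ω = x j) ∧ (∀ j : Fin K, j.val < k.val + 1 → R j ω = true)} := by
        ext ω
        refine ⟨fun h => ⟨h.2.1, fun j hj => ?_⟩, fun h => ⟨h.2 k (Nat.lt_succ_self _), h.1,
          fun j hj => h.2 j (Nat.lt_succ_of_lt hj)⟩⟩
        rcases Nat.lt_succ_iff_lt_or_eq.1 hj with hlt | heq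
        · exact h.2.2 j hlt
        · rw [Fin.ext heq]
          exact h.1
      rw [hset]
      rfl
    have h0 : Pr P {ω | ∀ k, X k ω = x k} = f 0 := by simp [f]
    have hK : Pr P {ω | (∀ k, X k ω = x k) ∧ (∀ k, R k ω = true)} = f K := by simp [f]
    have htelescope : ∏ i ∈ Finset.range K, f (i + 1) / f i = f K / f 0 :=
      Finset.prod_range_induction _ (fun n => f n / f 0) (div_self (hf 0)) K fun n _ => by
        rw [mul_comm, div_mul_div_cancel₀ (hf n)]
    rw [Finset.prod_congr rfl fun k _ => hstep k,
      Fin.prod_univ_eq_prod_range (fun n => f (n + 1) / f n) K, htelescope, h0, hK,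
      div_div_cancel₀ (hf K)]
  · congr 1
    ext ω
    refine and_congr_right fun hR => forall_congr' fun j => forall_congr' fun hj => ?_
    simp [hL, hR j hj]
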